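/- Let T be a tensor triangulated category with unit S, and let U be an invertible object of T (there exists an object U' with U ⊗ U' ≅ S). Assume that T is the smallest full triangulated subcategory of itself that is closed under isomorphisms and contains the objects U^{⊗n} for all integers n (where U^{⊗n} denotes the n-fold tensor power of U for n ≥ 0 and of U' for n < 0). Then for every class C of objects of T, the thick ideal generated by C equals Δ(⋃_{n ∈ ℤ} C ⊗ U^{⊗n}), the smallest thick subcategory of T containing all objects X ⊗ U^{⊗n} with X ∈ C and n ∈ ℤ. -/

import Mathlib

/-!
STATEMENT 11: In a tensor triangulated category generated as a triangulated category
by the tensor powers of an invertible object `U`, the thick ideal generated by a class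
`C` of objects is the thick subcategory generated by the objects `X ⊗ U^{⊗n}`, for
`X ∈ C` and `n ∈ ℤ`.
-/

open CategoryTheory CategoryTheory.Limits CategoryTheory.Pretriangulated MonoidalCategory

universe v u

/-- A thick subcategory of a pretriangulated category, encoded as a set of objects
which is nonempty, closed under isomorphisms, shifts, extensions (two-out-of-three
for distinguished triangles) and retracts. -/
structure ThickSubcategory (C : Type u) [Category.{v} C] [HasZeroObject C] [HasShift C ℤ]
    [Preadditive C] [∀ n : ℤ, (CategoryTheory.shiftFunctor C n).Additive]
    [Pretriangulated C] where
  set : Set C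
  nonempty : set.Nonempty
  iso_closed : ∀ ⦃X Y : C⦄, (X ≅ Y) → X ∈ set → Y ∈ set
  shift_closed : ∀ (X : C) (n : ℤ), X ∈ set → (X⟦n⟧ : C) ∈ set
  ext₃ : ∀ (T : Triangle C), (T ∈ distTriang C) → T.obj₁ ∈ set → T.obj₂ ∈ set → T.obj₃ ∈ set
  retract_closed : ∀ ⦃X Y : C⦄ (i : X ⟶ Y) (r : Y ⟶ X), i ≫ r = 𝟙 X → Y ∈ set → X ∈ set

/-- A full triangulated subcategory of a pretriangulated category, encoded as a set of
objects which is nonempty, closed under isomorphisms, shifts and extensions. -/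
structure TriangulatedSubcategory (C : Type u) [Category.{v} C] [HasZeroObject C]
    [HasShift C ℤ] [Preadditive C] [∀ n : ℤ, (CategoryTheory.shiftFunctor C n).Additive]
    [Pretriangulated C] where
  set : Set C
  nonempty : set.Nonempty
  iso_closed : ∀ ⦃X Y : C⦄, (X ≅ Y) → X ∈ set → Y ∈ set
  shift_closed : ∀ (X : C) (n : ℤ), X ∈ set → (X⟦n⟧ : C) ∈ set
  ext₃ : ∀ (T : Triangle C), (T ∈ distTriang C) → T.obj₁ ∈ set → T.obj₂ ∈ set → T.obj₃ ∈ set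

variable (C : Type u) [Category.{v} C] [HasZeroObject C] [HasShift C ℤ]
  [Preadditive C] [∀ n : ℤ, (CategoryTheory.shiftFunctor C n).Additive] [Pretriangulated C]
  [MonoidalCategory C] [SymmetricCategory C]

/-- The compatibility of the (symmetric) monoidal structure with the triangulation:
tensoring with any object sends distinguished triangles to distinguished triangles. -/
def TensorTriangulated : Prop :=
  ∀ (A : C) (T : Triangle C), (T ∈ distTriang C) →
    ∃ e : A ⊗ (T.obj₁⟦(1 : ℤ)⟧) ≅ (A ⊗ T.obj₁)⟦(1 : ℤ)⟧,
      Triangle.mk (A ◁ T.mor₁) (A ◁ T.mor₂) ((A ◁ T.mor₃) ≫ e.hom) ∈ distTriang C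

variable {C}

/-- A thick subcategory is a thick ideal if it absorbs tensoring by arbitrary objects. -/
def IsThickIdeal (S : ThickSubcategory C) : Prop :=
  ∀ (X : C) ⦃Y : C⦄, Y ∈ S.set → X ⊗ Y ∈ S.set

variable (C)

/-- The smallest thick ideal containing a given class of objects. -/
def thickIdealGen (A : Set C) : Set C :=
  {X : C | ∀ S : ThickSubcategory C, IsThickIdeal S → A ⊆ S.set → X ∈ S.set}

/-- `Δ A`: the smallest thick subcategory containing a given class of objects. -/
def thickSubcatGen (A : Set C) : Set C :=
  {X : C | ∀ S : ThickSubcategory C, A ⊆ S.set → X ∈ S.set}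

/-- The smallest full triangulated subcategory (closed under isomorphisms) containing
a given class of objects. -/
def triangulatedGen (A : Set C) : Set C :=
  {X : C | ∀ S : TriangulatedSubcategory C, A ⊆ S.set → X ∈ S.set}

variable {C}

/-- The `n`-fold tensor power of an object, for `n : ℕ`. -/
def npow (A : C) : ℕ → C
  | 0 => 𝟙_ C
  | n + 1 => A ⊗ npow A n

/-- `U^{⊗n}` for `n : ℤ`: the `n`-fold tensor power of `U` for `n ≥ 0`, and the
`(-n)`-fold tensor power of the tensor inverse `U'` for `n < 0`. -/
def zpow (U U' : C) : ℤ → C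
  | Int.ofNat n => npow U n
  | Int.negSucc n => npow U' (n + 1)

open scoped ZeroObject

/-- The shift commutes with tensoring on the left, up to (non canonical) isomorphism. -/
lemma tensor_shift_one (htt : TensorTriangulated C) (A X : C) :
    Nonempty (A ⊗ (X⟦(1 : ℤ)⟧) ≅ (A ⊗ X)⟦(1 : ℤ)⟧) := by
  obtain ⟨e, -⟩ := htt A _ (contractible_distinguished X)
  exact ⟨e⟩

lemma tensor_shift_nat (htt : TensorTriangulated C) (A : C) (n : ℕ) : ∀ X : C,
    Nonempty (A ⊗ (X⟦(n : ℤ)⟧) ≅ (A ⊗ X)⟦(n : ℤ)⟧) := by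
  induction n with
  | zero =>
    intro X
    exact ⟨(Iso.refl A ⊗ᵢ (shiftFunctorZero C ℤ).app X) ≪≫
      ((shiftFunctorZero C ℤ).app (A ⊗ X)).symm⟩
  | succ n ih =>
    intro X
    obtain ⟨a⟩ := ih X
    obtain ⟨b⟩ := tensor_shift_one htt A (X⟦(n : ℤ)⟧)
    have h : (n : ℤ) + 1 = ((n + 1 : ℕ) : ℤ) := by push_cast; rfl
    exact ⟨(Iso.refl A ⊗ᵢ (shiftFunctorAdd' C (n : ℤ) 1 _ h).app X) ≪≫ b ≪≫
      (shiftFunctor C (1 : ℤ)).mapIso a ≪≫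
      ((shiftFunctorAdd' C (n : ℤ) 1 _ h).app (A ⊗ X)).symm⟩

lemma tensor_shift (htt : TensorTriangulated C) (A X : C) (n : ℤ) :
    Nonempty (A ⊗ (X⟦n⟧) ≅ (A ⊗ X)⟦n⟧) := by
  obtain ⟨m, rfl | rfl⟩ := n.eq_nat_or_neg
  · exact tensor_shift_nat htt A m X
  · obtain ⟨a⟩ := tensor_shift_nat htt A m (X⟦(-(m : ℤ))⟧)
    have h1 : (m : ℤ) + -(m : ℤ) = 0 := by ring
    have h2 : -(m : ℤ) + (m : ℤ) = 0 := by ring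
    exact ⟨((shiftFunctorCompIsoId C (m : ℤ) (-(m : ℤ)) h1).app
        (A ⊗ X⟦(-(m : ℤ))⟧)).symm ≪≫
      (shiftFunctor C (-(m : ℤ))).mapIso (a.symm ≪≫
        (Iso.refl A ⊗ᵢ (shiftFunctorCompIsoId C (-(m : ℤ)) (m : ℤ) h2).app X))⟩

lemma isZero_tensor (htt : TensorTriangulated C) (A : C) {Z : C} (hZ : IsZero Z) :
    IsZero (A ⊗ Z) := by
  have e : Z ≅ 0 := hZ.isoZero
  obtain ⟨e', h⟩ := htt A _ (contractible_distinguished Z)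
  have h0 : IsZero (A ⊗ (0 : C)) := by
    have := (Triangle.isZero₃_iff_isIso₁ _ h).2 (show IsIso (A ◁ 𝟙 Z) by infer_instance)
    exact this
  exact h0.of_iso (Iso.refl A ⊗ᵢ e)

lemma ThickSubcategory.zero_mem (S : ThickSubcategory C) {Z : C} (hZ : IsZero Z) :
    Z ∈ S.set := by
  obtain ⟨X, hX⟩ := S.nonempty
  exact S.iso_closed hZ.isoZero.symm (S.ext₃ _ (contractible_distinguished X) hX hX)

/-- The thick subcategory of objects sent into `S` by tensoring with `B`. -/
def ThickSubcategory.preim (htt : TensorTriangulated C) (S : ThickSubcategory C) (B : C) :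
    ThickSubcategory C where
  set := {Y | B ⊗ Y ∈ S.set}
  nonempty := ⟨0, S.zero_mem (isZero_tensor htt B (isZero_zero C))⟩
  iso_closed X Y e hX := S.iso_closed (Iso.refl B ⊗ᵢ e) hX
  shift_closed X n hX :=
    S.iso_closed (tensor_shift htt B X n).some.symm (S.shift_closed _ n hX)
  ext₃ T hT h1 h2 := by
    obtain ⟨e, h⟩ := htt B T hT
    exact S.ext₃ _ h h1 h2
  retract_closed X Y i r h hY :=
    S.retract_closed (B ◁ i) (B ◁ r)
      (by rw [← MonoidalCategory.whiskerLeft_comp, h, MonoidalCategory.whiskerLeft_id]) hY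

/-- `thickSubcatGen` as a thick subcategory. -/
def thickGen (A : Set C) : ThickSubcategory C where
  set := thickSubcatGen C A
  nonempty := ⟨0, fun S _ => S.zero_mem (isZero_zero C)⟩
  iso_closed X Y e hX S hS := S.iso_closed e (hX S hS)
  shift_closed X n hX S hS := S.shift_closed X n (hX S hS)
  ext₃ T hT h1 h2 S hS := S.ext₃ T hT (h1 S hS) (h2 S hS)
  retract_closed X Y i r h hY S hS := S.retract_closed i r h (hY S hS)

lemma thickGen_subset (A : Set C) : A ⊆ (thickGen A).set := fun _ hX _ hS => hS hX

/-- The underlying triangulated subcategory of a thick subcategory. -/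
def ThickSubcategory.toTri (S : ThickSubcategory C) : TriangulatedSubcategory C where
  set := S.set
  nonempty := S.nonempty
  iso_closed := S.iso_closed
  shift_closed := S.shift_closed
  ext₃ := S.ext₃

/-- Cancelling an inverse. -/
def tensorCancelIso {U U' : C} (e : U ⊗ U' ≅ 𝟙_ C) (Y : C) : U ⊗ (U' ⊗ Y) ≅ Y :=
  (α_ U U' Y).symm ≪≫ (e ⊗ᵢ Iso.refl Y) ≪≫ λ_ Y

lemma zpow_succ (U U' : C) (e : U ⊗ U' ≅ 𝟙_ C) (n : ℤ) :
    ∃ m : ℤ, Nonempty (U ⊗ zpow U U' n ≅ zpow U U' m) := by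
  rcases n with n | n
  · exact ⟨Int.ofNat (n + 1), ⟨Iso.refl _⟩⟩
  · rcases n with _ | n
    · exact ⟨Int.ofNat 0, ⟨tensorCancelIso e _⟩⟩
    · exact ⟨Int.negSucc n, ⟨tensorCancelIso e _⟩⟩

lemma zpow_pred (U U' : C) (e : U ⊗ U' ≅ 𝟙_ C) (n : ℤ) :
    ∃ m : ℤ, Nonempty (U' ⊗ zpow U U' n ≅ zpow U U' m) := by
  rcases n with n | n
  · rcases n with _ | n
    · exact ⟨Int.negSucc 0, ⟨Iso.refl _⟩⟩
    · exact ⟨Int.ofNat n, ⟨tensorCancelIso (β_ U' U ≪≫ e) _⟩⟩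
  · exact ⟨Int.negSucc (n + 1), ⟨Iso.refl _⟩⟩

/-- Moving a factor past another one. -/
def swapIso (V X Y : C) : X ⊗ (V ⊗ Y) ≅ V ⊗ (X ⊗ Y) :=
  (α_ X V Y).symm ≪≫ (β_ X V ⊗ᵢ Iso.refl Y) ≪≫ α_ V X Y

lemma npow_mem (S : ThickSubcategory C) (V : C)
    (hV : ∀ Y ∈ S.set, V ⊗ Y ∈ S.set) (n : ℕ) (Y : C) (hY : Y ∈ S.set) :
    Y ⊗ npow V n ∈ S.set := by
  induction n with
  | zero => exact S.iso_closed (ρ_ Y).symm hY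
  | succ n ih => exact S.iso_closed (swapIso V Y (npow V n)).symm (hV _ ih)

lemma thickGen_closed (htt : TensorTriangulated C) (U U' V : C) (A : Set C)
    (hV : ∀ n : ℤ, ∃ m : ℤ, Nonempty (V ⊗ zpow U U' n ≅ zpow U U' m)) :
    ∀ Y ∈ (thickGen {Z : C | ∃ X ∈ A, ∃ n : ℤ, Z = X ⊗ zpow U U' n}).set,
      V ⊗ Y ∈ (thickGen {Z : C | ∃ X ∈ A, ∃ n : ℤ, Z = X ⊗ zpow U U' n}).set := by
  intro Y hY
  refine hY ((thickGen _).preim htt V) ?_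
  rintro _ ⟨X, hX, n, rfl⟩
  obtain ⟨m, ⟨f⟩⟩ := hV n
  exact (thickGen _).iso_closed ((Iso.refl X ⊗ᵢ f).symm ≪≫ swapIso V X _)
    (thickGen_subset _ ⟨X, hX, m, rfl⟩)

/-- Let `C` be a tensor triangulated category with unit `𝟙_ C`, and let `U` be an
invertible object (with inverse `U'`).  Assume `C` is the smallest full triangulated
subcategory of itself that is closed under isomorphisms and contains all `U^{⊗n}`,
`n ∈ ℤ`.  Then for every class `A` of objects of `C`, the thick ideal generated by
`A` equals the smallest thick subcategory containing all `X ⊗ U^{⊗n}` with `X ∈ A`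
and `n ∈ ℤ`. -/
theorem stmt_11 (htt : TensorTriangulated C)
    (U U' : C) (e : U ⊗ U' ≅ 𝟙_ C)
    (hgen : triangulatedGen C {Z : C | ∃ n : ℤ, Z = zpow U U' n} = Set.univ)
    (A : Set C) :
    thickIdealGen C A =
      thickSubcatGen C {Z : C | ∃ X ∈ A, ∃ n : ℤ, Z = X ⊗ zpow U U' n} := by
  apply Set.Subset.antisymm
  · intro W hW
    refine hW (thickGen {Z : C | ∃ X ∈ A, ∃ n : ℤ, Z = X ⊗ zpow U U' n}) ?_ ?_
    · intro X Y hY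
      have hX : X ∈ triangulatedGen C {Z : C | ∃ n : ℤ, Z = zpow U U' n} := by
        rw [hgen]; trivial
      refine (thickGen _).iso_closed (β_ Y X) (hX ((thickGen _).preim htt Y).toTri ?_)
      rintro _ ⟨n, rfl⟩
      rcases n with n | n
      · exact npow_mem _ U (thickGen_closed htt U U' U A (zpow_succ U U' e)) n Y hY
      · exact npow_mem _ U' (thickGen_closed htt U U' U' A (zpow_pred U U' e)) (n + 1) Y hY
    · intro X hX
      exact (thickGen _).iso_closed (ρ_ X) (thickGen_subset _ ⟨X, hX, 0, rfl⟩)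
  · intro W hW S hS hA
    refine hW S ?_
    rintro _ ⟨X, hX, n, rfl⟩
    exact S.iso_closed (β_ _ _) (hS _ (hA hX))
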